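/- Let U and V be two plane domains with smooth boundaries and let f: ∂U → ∂V be a bijective mapping that is a local isometry of the boundaries in the relative metrics. If the boundary ∂U of U is connected, then the boundary ∂V of V is also connected. -/

import Mathlib

open Set Filter Metric Topology ENNReal

noncomputable section

/-- A domain in `ℝⁿ`: a nonempty open connected set. -/
def IsDomainSet {n : ℕ} (U : Set (EuclideanSpace ℝ (Fin n))) : Prop :=
  IsOpen U ∧ IsConnected U

/-- The infimum of lengths of smooth paths joining `a` and `b` inside `U`. -/
def smoothPathInf {n : ℕ} (U : Set (EuclideanSpace ℝ (Fin n)))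
    (a b : EuclideanSpace ℝ (Fin n)) : ℝ≥0∞ :=
  ⨅ (γ : ℝ → EuclideanSpace ℝ (Fin n)) (_ : ContDiff ℝ 1 γ) (_ : γ 0 = a)
    (_ : γ 1 = b) (_ : ∀ t ∈ Icc (0:ℝ) 1, γ t ∈ U), eVariationOn γ (Icc 0 1)

/-- The relative metric `ρ_{∂U,U}`:
`ρ(x,y) = liminf_{x'→x, y'→y; x',y'∈U} inf{length γ : γ smooth path joining x',y' in U}`. -/
def relDist {n : ℕ} (U : Set (EuclideanSpace ℝ (Fin n)))
    (x y : EuclideanSpace ℝ (Fin n)) : ℝ≥0∞ :=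
  Filter.liminf (fun p : EuclideanSpace ℝ (Fin n) × EuclideanSpace ℝ (Fin n) =>
    smoothPathInf U p.1 p.2) ((𝓝[U] x) ×ˢ (𝓝[U] y))

/-- `f` is a bijection of `∂U` onto `∂V` which is a local isometry
in the relative metrics of the boundaries. -/
def IsBoundaryLocalIsometry {n : ℕ} (U V : Set (EuclideanSpace ℝ (Fin n)))
    (f : EuclideanSpace ℝ (Fin n) → EuclideanSpace ℝ (Fin n)) : Prop :=
  Set.BijOn f (frontier U) (frontier V) ∧
  ∀ y ∈ frontier U, ∃ ε : ℝ≥0∞, 0 < ε ∧ ∀ a ∈ frontier U, ∀ b ∈ frontier U,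
    relDist U a y < ε → relDist U b y < ε →
      relDist U a b = relDist V (f a) (f b)

/-- `U` has smooth boundary: `∂U` is an `(n-1)`-dimensional submanifold of
class `C¹` without boundary, i.e. near each of its points the frontier can be
mapped by a `C¹` diffeomorphism onto an open piece of a hyperplane. -/
def HasC1Boundary {n : ℕ} (U : Set (EuclideanSpace ℝ (Fin n))) : Prop :=
  ∀ x ∈ frontier U, ∃ (W W' : Set (EuclideanSpace ℝ (Fin n)))
    (φ ψ : EuclideanSpace ℝ (Fin n) → EuclideanSpace ℝ (Fin n))
    (ℓ : EuclideanSpace ℝ (Fin n) →L[ℝ] ℝ),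
    IsOpen W ∧ x ∈ W ∧ IsOpen W' ∧ ℓ ≠ 0 ∧
    ContDiffOn ℝ 1 φ W ∧ ContDiffOn ℝ 1 ψ W' ∧
    Set.MapsTo φ W W' ∧ Set.MapsTo ψ W' W ∧
    (∀ z ∈ W, ψ (φ z) = z) ∧ (∀ z ∈ W', φ (ψ z) = z) ∧
    φ '' (W ∩ frontier U) = W' ∩ {y | ℓ y = 0}

/-- The intrinsic distance inside a set `S`: the infimum of lengths of
(continuous) paths joining `a` and `b` inside `S`. -/
def intrinsicDist {n : ℕ} (S : Set (EuclideanSpace ℝ (Fin n)))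
    (a b : EuclideanSpace ℝ (Fin n)) : ℝ≥0∞ :=
  ⨅ (γ : ℝ → EuclideanSpace ℝ (Fin n)) (_ : ContinuousOn γ (Icc (0:ℝ) 1))
    (_ : γ 0 = a) (_ : γ 1 = b) (_ : ∀ t ∈ Icc (0:ℝ) 1, γ t ∈ S),
    eVariationOn γ (Icc 0 1)

/-- The relative metric dominates the Euclidean one. -/
theorem edist_le_relDist {n : ℕ} (U : Set (EuclideanSpace ℝ (Fin n)))
    (a b : EuclideanSpace ℝ (Fin n)) : edist a b ≤ relDist U a b := by
  refine le_of_forall_lt fun c hc => ?_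
  obtain ⟨d, hcd, hd⟩ := exists_between hc
  refine lt_of_lt_of_le hcd ?_
  refine Filter.le_liminf_of_le (by isBoundedDefault) ?_
  have hle : (𝓝[U] a) ×ˢ (𝓝[U] b) ≤ 𝓝 (a, b) := by
    rw [nhds_prod_eq]
    exact Filter.prod_mono nhdsWithin_le_nhds nhdsWithin_le_nhds
  have hcont : Continuous fun p : EuclideanSpace ℝ (Fin n) × EuclideanSpace ℝ (Fin n) =>
      edist p.1 p.2 := by fun_prop
  filter_upwards [hle (hcont.continuousAt.eventually (lt_mem_nhds hd))] with p hp
  refine hp.le.trans ?_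
  simp only [smoothPathInf, le_iInf_iff]
  intro γ _ h0 h1 _
  rw [← h0, ← h1]
  exact eVariationOn.edist_le γ (by simp) (by simp)

/-- If `ψ` is a `K`-Lipschitz `C¹` map on a convex set `H` and maps it into `U`, then images of
points `A`, `B` of `H` are joined in `U` by smooth paths of length at most `K * edist A B`. -/
theorem smoothPathInf_le_of_lipschitzOnWith {n : ℕ} {U H : Set (EuclideanSpace ℝ (Fin n))}
    {ψ : EuclideanSpace ℝ (Fin n) → EuclideanSpace ℝ (Fin n)} {K : NNReal}
    (hH : Convex ℝ H) (hψ : ContDiffOn ℝ 1 ψ H) (hK : LipschitzOnWith K ψ H)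
    (hmaps : MapsTo ψ H U) {A B : EuclideanSpace ℝ (Fin n)} (hA : A ∈ H) (hB : B ∈ H) :
    smoothPathInf U (ψ A) (ψ B) ≤ K * edist A B := by
  have hmem : ∀ t : ℝ, AffineMap.lineMap A B (Real.smoothTransition t) ∈ H := fun t =>
    hH.lineMap_mem hA hB ⟨Real.smoothTransition.nonneg t, Real.smoothTransition.le_one t⟩
  have hsm : ContDiff ℝ 1 (fun t : ℝ => AffineMap.lineMap A B (Real.smoothTransition t)) := by
    have : ContDiff ℝ 1 Real.smoothTransition := Real.smoothTransition.contDiff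
    simp only [AffineMap.lineMap_apply_module']
    fun_prop
  have hvar : eVariationOn (fun t : ℝ => ψ (AffineMap.lineMap A B (Real.smoothTransition t)))
      (Icc 0 1) ≤ K * edist A B := by
    have hline : LipschitzWith (nndist A B) (AffineMap.lineMap A B : ℝ → _) :=
      lipschitzWith_lineMap A B
    have hs : eVariationOn Real.smoothTransition (Icc 0 1) = 1 := by
      have := (Real.smoothTransition.monotone.monotoneOn (Icc 0 1)).eVariationOn_eq
        (a := 0) (b := 1) (by simp) (by simp)
      simpa using this
    calc _ ≤ (K : ℝ≥0∞) * eVariationOn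
          (fun t : ℝ => AffineMap.lineMap A B (Real.smoothTransition t)) (Icc 0 1) :=
          hK.comp_eVariationOn_le fun t _ => hmem t
      _ ≤ K * ((nndist A B : NNReal) * eVariationOn Real.smoothTransition (Icc 0 1)) := by
          gcongr
          exact hline.lipschitzOnWith.comp_eVariationOn_le (mapsTo_univ _ _)
      _ ≤ K * (edist A B * 1) := by
          rw [edist_nndist, hs]
      _ = _ := by rw [mul_one]
  refine le_trans ?_ hvar
  refine iInf₂_le_of_le _ (hψ.comp_contDiff hsm hmem) ?_
  refine iInf₂_le_of_le (by simp) (by simp) ?_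
  exact iInf_le_of_le (fun t _ => hmaps (hmem t)) le_rfl

/-- A preconnected set that meets `U` but not its frontier lies in `U`. -/
theorem IsPreconnected.subset_of_disjoint_frontier {X : Type*} [TopologicalSpace X] {s U : Set X}
    (hs : IsPreconnected s) (hd : ∀ z ∈ s, z ∉ frontier U) (hne : (s ∩ U).Nonempty) :
    s ⊆ U := by
  have hcover : s ⊆ interior U ∪ (closure U)ᶜ := by
    intro z hz
    by_cases h : z ∈ closure U
    · exact Or.inl (by_contra fun hi => hd z hz ⟨h, hi⟩)
    · exact Or.inr h
  have hdisj : Disjoint (interior U) (closure U)ᶜ :=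
    disjoint_compl_right.mono_left (interior_subset.trans subset_closure)
  have hmeet : (s ∩ interior U).Nonempty := by
    obtain ⟨z, hz, hzU⟩ := hne
    exact ⟨z, hz, (hcover hz).resolve_right fun h => h (subset_closure hzU)⟩
  exact (hs.subset_left_of_subset_union isOpen_interior isClosed_closure.isOpen_compl hdisj
    hcover hmeet).trans interior_subset

/-- Along a `C¹` boundary the relative metric is continuous for the Euclidean topology. -/
theorem tendsto_relDist_frontier {n : ℕ} {U : Set (EuclideanSpace ℝ (Fin n))}
    (hU : IsOpen U) (hUb : HasC1Boundary U) {y : EuclideanSpace ℝ (Fin n)}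
    (hy : y ∈ frontier U) :
    Tendsto (fun a => relDist U a y) (𝓝[frontier U] y) (𝓝 0) := by
  obtain ⟨W, W', φ, ψ, ℓ, hW, hyW, hW', hℓ, hφ, hψ, hφm, hψm, hl, hr, him⟩ := hUb y hy
  have hzero : ∀ a ∈ W, a ∈ frontier U → ℓ (φ a) = 0 := fun a ha ha' =>
    (him.subset (mem_image_of_mem φ ⟨ha, ha'⟩)).2
  have hfront : ∀ z ∈ W', ℓ z = 0 → ψ z ∈ frontier U := by
    intro z hz hz0
    obtain ⟨w, ⟨hw, hw'⟩, rfl⟩ := him.superset ⟨hz, hz0⟩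
    rwa [hl w hw]
  have hqW' : φ y ∈ W' := hφm hyW
  obtain ⟨K, s, hs, hK⟩ := (hψ.contDiffAt (hW'.mem_nhds hqW')).exists_lipschitzOnWith
  obtain ⟨r, hr0, hball⟩ := Metric.mem_nhds_iff.1 (inter_mem hs (hW'.mem_nhds hqW'))
  have hφc : ContinuousAt φ y := hφ.continuousOn.continuousAt (hW.mem_nhds hyW)
  have hev : ∀ᶠ a in 𝓝 y, a ∈ W ∧ φ a ∈ ball (φ y) r :=
    (hW.eventually_mem hyW).and (hφc.eventually (ball_mem_nhds _ hr0))
  obtain ⟨u, ⟨huW, hub⟩, huU⟩ := mem_closure_iff_nhds.1 (frontier_subset_closure hy) _ hev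
  have hu0 : ℓ (φ u) ≠ 0 := by
    intro h
    have := hfront _ (hφm huW) h
    rw [hl u huW, hU.frontier_eq] at this
    exact this.2 huU
  obtain ⟨m, hmu, hm⟩ : ∃ m : EuclideanSpace ℝ (Fin n) →L[ℝ] ℝ,
      0 < m (φ u) ∧ ∀ z, m z = 0 ↔ ℓ z = 0 := by
    rcases lt_or_gt_of_ne hu0 with h | h
    · exact ⟨-ℓ, by simpa using h, fun z => by simp⟩
    · exact ⟨ℓ, h, fun z => Iff.rfl⟩
  set v := φ u
  set H : Set (EuclideanSpace ℝ (Fin n)) := ball (φ y) r ∩ {z | 0 < m z} with hHdef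
  have hH : Convex ℝ H :=
    (convex_ball _ _).inter (convex_halfSpace_gt m.isLinear 0)
  have hHW : H ⊆ W' := fun z hz => (hball hz.1).2
  have hψH : ContDiffOn ℝ 1 ψ H := hψ.mono hHW
  have hmaps : MapsTo ψ H U := by
    rw [mapsTo_iff_image_subset]
    refine IsPreconnected.subset_of_disjoint_frontier
      (hH.isPreconnected.image _ hψH.continuousOn) ?_
      ⟨u, ⟨v, ⟨hub, hmu⟩, hl u huW⟩, huU⟩
    rintro _ ⟨z, hz, rfl⟩ hzf
    have h0 := hzero _ (hψm (hHW hz)) hzf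
    rw [hr z (hHW hz), ← hm] at h0
    exact hz.2.ne' h0
  have hKH : LipschitzOnWith K ψ H := hK.mono fun z hz => (hball hz.1).1
  have happroach : ∀ a ∈ W, a ∈ frontier U → φ a ∈ ball (φ y) r →
      (∀ᶠ t : ℝ in 𝓝[>] 0, φ a + t • v ∈ H) ∧
        Tendsto (fun t : ℝ => ψ (φ a + t • v)) (𝓝[>] 0) (𝓝[U] a) := by
    intro a haW haf hab
    have hlim : Tendsto (fun t : ℝ => φ a + t • v) (𝓝[>] 0) (𝓝 (φ a)) := by
      have : Continuous fun t : ℝ => φ a + t • v := by fun_prop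
      simpa using (this.tendsto 0).mono_left nhdsWithin_le_nhds
    have hin : ∀ᶠ t : ℝ in 𝓝[>] 0, φ a + t • v ∈ H := by
      filter_upwards [hlim.eventually (isOpen_ball.mem_nhds hab), self_mem_nhdsWithin] with t ht ht0
      refine ⟨ht, ?_⟩
      have : m (φ a) = 0 := (hm _).2 (hzero a haW haf)
      simpa [this] using mul_pos ht0 hmu
    refine ⟨hin, tendsto_nhdsWithin_iff.2 ⟨?_, hin.mono fun t ht => hmaps ht⟩⟩
    have hc : Tendsto ψ (𝓝 (φ a)) (𝓝 (ψ (φ a))) :=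
      hψ.continuousOn.continuousAt (hW'.mem_nhds (hφm haW))
    rw [hl a haW] at hc
    exact hc.comp hlim
  have hbound : ∀ᶠ a in 𝓝[frontier U] y, relDist U a y ≤ K * edist (φ a) (φ y) := by
    filter_upwards [nhdsWithin_le_nhds hev, self_mem_nhdsWithin] with a ⟨haW, hab⟩ haf
    obtain ⟨hinA, htA⟩ := happroach a haW haf hab
    obtain ⟨hinB, htB⟩ := happroach y hyW hy (mem_ball_self hr0)
    refine Filter.liminf_le_of_frequently_le' ((htA.prodMk htB).frequently ?_)
    refine Filter.Eventually.frequently ?_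
    filter_upwards [hinA, hinB] with t hA hB
    simpa using smoothPathInf_le_of_lipschitzOnWith hH hψH hKH hmaps hA hB
  refine tendsto_of_tendsto_of_tendsto_of_le_of_le' tendsto_const_nhds ?_
    (Eventually.of_forall fun _ => zero_le) hbound
  have he : Tendsto (fun a => edist (φ a) (φ y)) (𝓝[frontier U] y) (𝓝 0) :=
    tendsto_iff_edist_tendsto_0.1 (hφc.tendsto.mono_left nhdsWithin_le_nhds)
  simpa using ENNReal.Tendsto.const_mul he (Or.inr (ENNReal.coe_ne_top (r := K)))

/-- A boundary local isometry is continuous for the Euclidean topologies. -/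
theorem IsBoundaryLocalIsometry.continuousOn {n : ℕ} {U V : Set (EuclideanSpace ℝ (Fin n))}
    {f : EuclideanSpace ℝ (Fin n) → EuclideanSpace ℝ (Fin n)}
    (hf : IsBoundaryLocalIsometry U V f) (hU : IsOpen U) (hUb : HasC1Boundary U) :
    ContinuousOn f (frontier U) := by
  intro y hy
  obtain ⟨ε, hε, hiso⟩ := hf.2 y hy
  have hlim := tendsto_relDist_frontier hU hUb hy
  have hsmall : ∀ᶠ a in 𝓝[frontier U] y, relDist U a y < ε := hlim.eventually (gt_mem_nhds hε)
  have hyy : relDist U y y < ε := hsmall.self_of_nhdsWithin hy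
  refine tendsto_iff_edist_tendsto_0.2 ?_
  refine tendsto_of_tendsto_of_tendsto_of_le_of_le' tendsto_const_nhds hlim
    (Eventually.of_forall fun _ => zero_le) ?_
  filter_upwards [hsmall, self_mem_nhdsWithin] with a ha haf
  rw [hiso a haf y hy ha hyy]
  exact edist_le_relDist V (f a) (f y)

/-- if the boundary of `U` is connected, then so is the boundary of `V`. -/
theorem connected_boundary_of_local_isometry
    (U V : Set (EuclideanSpace ℝ (Fin 2)))
    (hU : IsDomainSet U) (hV : IsDomainSet V)
    (hUb : HasC1Boundary U) (hVb : HasC1Boundary V)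
    (f : EuclideanSpace ℝ (Fin 2) → EuclideanSpace ℝ (Fin 2))
    (hf : IsBoundaryLocalIsometry U V f)
    (hconn : IsConnected (frontier U)) :
    IsConnected (frontier V) := by
  rw [← hf.1.image_eq]
  exact hconn.image f (hf.continuousOn hU.1 hUb)

end
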